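/- arXiv:2509.02743 — 7 statements merged into one kernel-verified Lean document; each statement's English description precedes it below -/
import Mathlib

section
/- Let d, r ≥ 1, let ρ be a density matrix on ℂ^d ⊗ ℂ^d with Schmidt number at most r, and let (G_μ)_{μ ∈ Fin (d^2)} and (H_μ)_{μ ∈ Fin (d^2)} be Hermitian orthonormal operator bases of the d × d complex matrices. Set, for each μ, a_μ = Re tr(ρ (G_μ ⊗ I)), b_μ = Re tr(ρ (I ⊗ H_μ)), and X_μ = Re tr(ρ (G_μ ⊗ H_μ)) − a_μ · b_μ. Then Σ_μ |X_μ| − √((1 − Σ_μ a_μ²) · (1 − Σ_μ b_μ²)) + 1 ≤ r. -/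
open Matrix Kronecker BigOperators
open scoped ComplexOrder

/-- The `d × d` matrix associated to a bipartite vector on `ℂ^d ⊗ ℂ^d`. -/
noncomputable def assocMatrix {d : ℕ} (ψ : Fin d × Fin d → ℂ) : Matrix (Fin d) (Fin d) ℂ :=
  Matrix.of fun i j => ψ (i, j)

/-- A density matrix: positive semidefinite with unit trace. -/
def IsDensityMatrix {n : Type*} [Fintype n] [DecidableEq n] (ρ : Matrix n n ℂ) : Prop :=
  ρ.PosSemidef ∧ ρ.trace = 1

/-- `ρ` has Schmidt number at most `r`: it is a convex mixture of pure states
whose associated matrices have rank at most `r`. -/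
def SchmidtNumberLE (d r : ℕ) (ρ : Matrix (Fin d × Fin d) (Fin d × Fin d) ℂ) : Prop :=
  ∃ (K : ℕ) (p : Fin K → ℝ) (ψ : Fin K → (Fin d × Fin d → ℂ)),
    (∀ k, 0 ≤ p k) ∧ (∑ k, p k = 1) ∧
    (∀ k, ∑ ij, Complex.normSq (ψ k ij) = 1) ∧
    (∀ k, (assocMatrix (ψ k)).rank ≤ r) ∧
    ρ = ∑ k, (p k : ℂ) • Matrix.vecMulVec (ψ k) (star (ψ k))

/-- A Hermitian orthonormal operator basis of the `d × d` complex matrices. -/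
def IsHermitianONB (d : ℕ) (G : Fin (d ^ 2) → Matrix (Fin d) (Fin d) ℂ) : Prop :=
  (∀ μ, (G μ).IsHermitian) ∧
  (∀ μ ν, ((G μ)ᴴ * G ν).trace = if μ = ν then 1 else 0)

theorem diag_bound {d : ℕ} (s : Fin d → ℝ) (hs : ∀ i, 0 ≤ s i) (h1 : ∑ i, s i ^ 2 = 1)
    (G H : Matrix (Fin d) (Fin d) ℂ) (hH : H.IsHermitian) :
    |(∑ i, ∑ j, s i * s j * (G i j * H i j).re) -
      (∑ i, s i ^ 2 * (G i i).re) * (∑ i, s i ^ 2 * (H i i).re)| ≤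
    (((∑ i, ∑ j, s i * s j * Complex.normSq (G i j)) - (∑ i, s i ^ 2 * (G i i).re) ^ 2) +
    ((∑ i, ∑ j, s i * s j * Complex.normSq (H i j)) - (∑ i, s i ^ 2 * (H i i).re) ^ 2)) / 2 := by
  have key : ∀ L : Matrix (Fin d) (Fin d) ℂ,
      (∑ i, s i ^ 2 * (L i i).re) ^ 2 ≤ ∑ i, ∑ j, s i * s j * Complex.normSq (L i j) := by
    intro L
    have e1 : (∑ i, s i ^ 2 * (L i i).re) ^ 2 ≤ (∑ i, s i ^ 2) * ∑ i, (s i * (L i i).re) ^ 2 := by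
      have := Finset.sum_mul_sq_le_sq_mul_sq Finset.univ s (fun i => s i * (L i i).re)
      calc _ = (∑ i, s i * (s i * (L i i).re)) ^ 2 := by
            congr 1; exact Finset.sum_congr rfl fun i _ => by ring
        _ ≤ _ := this
    rw [h1, one_mul] at e1
    refine e1.trans (Finset.sum_le_sum fun i _ => ?_)
    calc (s i * (L i i).re) ^ 2 ≤ s i * s i * Complex.normSq (L i i) := by
          rw [Complex.normSq_apply]; nlinarith [mul_nonneg (sq_nonneg (s i)) (sq_nonneg (L i i).im)]
      _ ≤ _ := Finset.single_le_sum (f := fun j => s i * s j * Complex.normSq (L i j))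
          (fun j _ => mul_nonneg (mul_nonneg (hs i) (hs j)) (Complex.normSq_nonneg _))
          (Finset.mem_univ i)
  have expand : ∀ c : ℝ, c ^ 2 = 1 →
      (∑ i, ∑ j, s i * s j * Complex.normSq ((G + (c : ℂ) • Hᵀ) i j)) =
      (∑ i, ∑ j, s i * s j * Complex.normSq (G i j)) +
      (∑ i, ∑ j, s i * s j * Complex.normSq (H i j)) +
      2 * c * (∑ i, ∑ j, s i * s j * (G i j * H i j).re) := by
    intro c hc
    simp only [Finset.mul_sum, ← Finset.sum_add_distrib]
    refine Finset.sum_congr rfl fun i _ => Finset.sum_congr rfl fun j _ => ?_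
    have : H j i = star (H i j) := (hH.apply j i).symm
    simp only [Matrix.add_apply, Matrix.smul_apply, Matrix.transpose_apply, this,
      Complex.normSq_apply, smul_eq_mul, Complex.add_re, Complex.mul_re, Complex.add_im,
      Complex.mul_im, Complex.ofReal_re, Complex.ofReal_im, Complex.star_def, Complex.conj_re,
      Complex.conj_im]
    linear_combination (s i * s j * ((H i j).re ^ 2 + (H i j).im ^ 2)) * hc
  have ex2 : ∀ c : ℝ, (∑ i, s i ^ 2 * ((G + (c : ℂ) • Hᵀ) i i).re) =
      (∑ i, s i ^ 2 * (G i i).re) + c * (∑ i, s i ^ 2 * (H i i).re) := by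
    intro c
    simp only [Finset.mul_sum, ← Finset.sum_add_distrib]
    refine Finset.sum_congr rfl fun i _ => ?_
    simp; ring
  have p1 := key (G + ((1 : ℝ) : ℂ) • Hᵀ)
  have p2 := key (G + ((-1 : ℝ) : ℂ) • Hᵀ)
  rw [expand 1 (by norm_num), ex2] at p1
  rw [expand (-1) (by norm_num), ex2] at p2
  rw [abs_le]
  constructor <;> nlinarith

theorem onb_complete {d : ℕ} {G : Fin (d ^ 2) → Matrix (Fin d) (Fin d) ℂ}
    (hG : IsHermitianONB d G) (x y : Fin d × Fin d) :
    ∑ μ, star (G μ x.1 x.2) * G μ y.1 y.2 = if x = y then 1 else 0 := by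
  let E : Matrix (Fin (d ^ 2)) (Fin d × Fin d) ℂ := Matrix.of fun μ x => G μ x.1 x.2
  have h : E.map star * Eᵀ = 1 := by
    ext μ ν
    have := hG.2 μ ν
    rw [Matrix.one_apply, ← this, Matrix.trace, Matrix.mul_apply, Fintype.sum_prod_type,
      Finset.sum_comm]
    simp [E, Matrix.mul_apply]
  have h2 : Eᵀ * E.map star = 1 :=
    (Matrix.mul_eq_one_comm_of_card_eq _ _ _ (by simp [sq])).1 h
  have := congrFun (congrFun h2 y) x
  simp only [Matrix.mul_apply, Matrix.one_apply, E, Matrix.transpose_apply, Matrix.map_apply,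
    Matrix.of_apply] at this
  have e : (if x = y then (1 : ℂ) else 0) = if y = x then 1 else 0 := by
    simp only [eq_comm]
  rw [e, ← this]
  exact Finset.sum_congr rfl fun μ _ => mul_comm _ _

theorem onb_conj {d : ℕ} {G : Fin (d ^ 2) → Matrix (Fin d) (Fin d) ℂ}
    (hG : IsHermitianONB d G) (U : Matrix (Fin d) (Fin d) ℂ) (hU : U * Uᴴ = 1) :
    IsHermitianONB d (fun μ => Uᴴ * G μ * U) := by
  refine ⟨fun μ => Matrix.isHermitian_conjTranspose_mul_mul U (hG.1 μ), fun μ ν => ?_⟩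
  rw [← hG.2 μ ν]
  have : (Uᴴ * G μ * U)ᴴ * (Uᴴ * G ν * U) = Uᴴ * ((G μ)ᴴ * G ν * U) := by
    simp only [Matrix.conjTranspose_mul, Matrix.conjTranspose_conjTranspose, Matrix.mul_assoc]
    rw [← Matrix.mul_assoc U Uᴴ, hU, Matrix.one_mul]
  simp only [this]
  rw [Matrix.trace_mul_comm, Matrix.mul_assoc, hU, Matrix.mul_one]

theorem onb_normSq {d : ℕ} {G : Fin (d ^ 2) → Matrix (Fin d) (Fin d) ℂ}
    (hG : IsHermitianONB d G) (i j : Fin d) : ∑ μ, Complex.normSq (G μ i j) = 1 := by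
  have := congrArg Complex.re (onb_complete hG (i, j) (i, j))
  simp only [if_true, Complex.re_sum, Complex.one_re] at this
  rw [← this]
  refine Finset.sum_congr rfl fun μ _ => ?_
  simp [Complex.normSq_apply]

theorem onb_diag {d : ℕ} {G : Fin (d ^ 2) → Matrix (Fin d) (Fin d) ℂ}
    (hG : IsHermitianONB d G) (l : Fin d → ℝ) :
    ∑ μ, (∑ i, l i * (G μ i i).re) ^ 2 = ∑ i, l i ^ 2 := by
  have h : ∀ i j, ∑ μ, (G μ i i).re * (G μ j j).re = if i = j then 1 else 0 := by
    intro i j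
    have := congrArg Complex.re (onb_complete hG (i, i) (j, j))
    have e : (if ((i, i) : Fin d × Fin d) = (j, j) then (1 : ℂ) else 0).re =
      if i = j then 1 else 0 := by
      by_cases hij : i = j <;> simp [hij]
    rw [e] at this
    rw [← this, Complex.re_sum]
    refine Finset.sum_congr rfl fun μ _ => ?_
    have h0 : (G μ i i).im = 0 := Complex.conj_eq_iff_im.1 ((hG.1 μ).apply i i)
    simp [h0]
  simp only [sq, Finset.sum_mul_sum]
  rw [Finset.sum_comm]
  refine Finset.sum_congr rfl fun i _ => ?_
  rw [Finset.sum_comm]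
  have : ∀ j, ∑ μ, l i * (G μ i i).re * (l j * (G μ j j).re) = l i * l j * if i = j then 1 else 0 := by
    intro j
    rw [← h i j, Finset.mul_sum]
    exact Finset.sum_congr rfl fun μ _ => by ring
  simp [this]

theorem svd_ex {d : ℕ} (M : Matrix (Fin d) (Fin d) ℂ) :
    ∃ (U V : Matrix (Fin d) (Fin d) ℂ) (s : Fin d → ℝ), U * Uᴴ = 1 ∧ V * Vᴴ = 1 ∧
      (∀ i, 0 ≤ s i) ∧ (Finset.univ.filter fun i => s i ≠ 0).card = M.rank ∧
      M = U * Matrix.diagonal (fun i => (s i : ℂ)) * Vᵀ := by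
  have hA := Matrix.isHermitian_conjTranspose_mul_self M
  have hnn : ∀ i, 0 ≤ hA.eigenvalues i := Matrix.eigenvalues_conjTranspose_mul_self_nonneg M
  obtain ⟨W, hW1, hW2, hW⟩ : ∃ W : Matrix (Fin d) (Fin d) ℂ, W * Wᴴ = 1 ∧ Wᴴ * W = 1 ∧
      Wᴴ * (Mᴴ * M) * W = Matrix.diagonal (fun i => (hA.eigenvalues i : ℂ)) := by
    refine ⟨hA.eigenvectorUnitary, ?_, ?_, ?_⟩
    · exact Unitary.coe_mul_star_self hA.eigenvectorUnitary
    · exact Unitary.coe_star_mul_self hA.eigenvectorUnitary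
    · have := hA.conjStarAlgAut_star_eigenvectorUnitary
      rw [Unitary.conjStarAlgAut_apply] at this
      simpa [Matrix.star_eq_conjTranspose, Function.comp_def] using this
  set N := M * W with hN
  have hNN : Nᴴ * N = Matrix.diagonal (fun i => (hA.eigenvalues i : ℂ)) := by
    rw [← hW, hN, Matrix.conjTranspose_mul]; simp only [Matrix.mul_assoc]
  let n : Fin d → EuclideanSpace ℂ (Fin d) := fun i => WithLp.toLp 2 (fun a => N a i)
  have hin : ∀ i j, inner ℂ (n i) (n j) = if i = j then (hA.eigenvalues i : ℂ) else 0 := by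
    intro i j
    have := congrFun (congrFun hNN i) j
    rw [Matrix.diagonal_apply] at this
    rw [← this, EuclideanSpace.inner_eq_star_dotProduct]
    simp [n, Matrix.mul_apply, dotProduct, mul_comm]
  let s : Fin d → ℝ := fun i => Real.sqrt (hA.eigenvalues i)
  have hss : ∀ i, s i * s i = hA.eigenvalues i := fun i => Real.mul_self_sqrt (hnn i)
  have hs0 : ∀ i, s i ≠ 0 ↔ hA.eigenvalues i ≠ 0 := fun i => by
    rw [not_iff_not]; exact Real.sqrt_eq_zero (hnn i)
  let S : Set (Fin d) := {i | s i ≠ 0}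
  have hv : Orthonormal ℂ (S.domRestrict fun i => ((s i : ℂ)⁻¹) • n i) := by
    rw [orthonormal_iff_ite]
    rintro ⟨i, hi⟩ ⟨j, hj⟩
    have hi' : (s i : ℂ) ≠ 0 := by exact_mod_cast hi
    simp only [Set.domRestrict_apply, inner_smul_left, inner_smul_right, hin, Subtype.mk.injEq]
    by_cases h : i = j
    · subst h
      simp only [if_true, ← hss i]
      simp
      field_simp
    · simp [h]
  obtain ⟨b, hb⟩ := hv.exists_orthonormalBasis_extension_of_card_eq (by simp)
  let U : Matrix (Fin d) (Fin d) ℂ := Matrix.of fun a i => b i a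
  have hU : Uᴴ * U = 1 := by
    ext i j
    have := (orthonormal_iff_ite.1 b.orthonormal) i j
    rw [Matrix.one_apply, ← this, EuclideanSpace.inner_eq_star_dotProduct]
    simp [U, Matrix.mul_apply, dotProduct, mul_comm]
  have hND : N = U * Matrix.diagonal (fun i => (s i : ℂ)) := by
    ext a i
    rw [Matrix.mul_diagonal]
    by_cases hi : s i = 0
    · have h0 : n i = 0 := by
        rw [← inner_self_eq_zero (𝕜 := ℂ), hin, if_pos rfl, ← hss, hi]; simp
      have : n i a = 0 := by rw [h0]; rfl
      simpa [hi, n] using this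
    · have := hb i hi
      have hi' : (s i : ℂ) ≠ 0 := by exact_mod_cast hi
      simp only [U, Matrix.of_apply, this, n]
      simp
      field_simp
  refine ⟨U, Wᴴᵀ, s, mul_eq_one_comm.1 hU, ?_, fun i => Real.sqrt_nonneg _, ?_, ?_⟩
  · have : (Wᴴᵀ)ᴴ = Wᵀ := by ext; simp
    rw [this, ← Matrix.transpose_mul, hW1, Matrix.transpose_one]
  · rw [← Matrix.rank_conjTranspose_mul_self, hA.rank_eq_card_non_zero_eigs, Fintype.card_subtype]
    congr 1
    ext i; simp [hs0]
  · rw [Matrix.transpose_transpose, ← hND, hN, Matrix.mul_assoc, hW1, Matrix.mul_one]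

theorem pure_trace {d : ℕ} (ψ : Fin d × Fin d → ℂ) (U V : Matrix (Fin d) (Fin d) ℂ)
    (s : Fin d → ℝ)
    (h : assocMatrix ψ = U * Matrix.diagonal (fun i => (s i : ℂ)) * Vᵀ)
    (A B : Matrix (Fin d) (Fin d) ℂ) :
    (Matrix.vecMulVec ψ (star ψ) * (A ⊗ₖ B)).trace =
      ∑ i, ∑ j, (s i : ℂ) * s j * ((Uᴴ * A * U) i j * (Vᴴ * B * V) i j) := by
  set M := assocMatrix ψ with hM
  set D := Matrix.diagonal (fun i => (s i : ℂ)) with hD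
  have e1 : (Matrix.vecMulVec ψ (star ψ) * (A ⊗ₖ B)).trace = (Mᴴ * A * M * Bᵀ).trace := by
    rw [Matrix.vecMulVec_mul, Matrix.trace_vecMulVec, dotProduct_comm,
      ← Matrix.dotProduct_mulVec]
    have hv : ψ = Mᵀ.vec := by ext ⟨i, j⟩; rfl
    have h2 : (A ⊗ₖ B) *ᵥ ψ = (B * Mᵀ * Aᵀ).vec := by
      conv_lhs => rw [hv]
      exact Matrix.kronecker_mulVec_vec B Mᵀ A
    rw [h2]
    have h3 : star ψ ⬝ᵥ (B * Mᵀ * Aᵀ).vec = ((M.map star) * (B * Mᵀ * Aᵀ)).trace := by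
      simp only [dotProduct, Matrix.trace, Matrix.diag, Matrix.mul_apply (M := M.map star),
        Fintype.sum_prod_type]
      rfl
    rw [h3, ← Matrix.trace_transpose]
    simp only [Matrix.transpose_mul, Matrix.transpose_transpose]
    have h4 : (M.map star)ᵀ = Mᴴ := rfl
    rw [h4, Matrix.trace_mul_comm]
    simp only [Matrix.mul_assoc]
  have hDD : Dᴴ = D := by
    rw [hD, Matrix.diagonal_conjTranspose]; congr 1; ext i; simp
  have e2 : (Mᴴ * A * M * Bᵀ).trace = (D * (Uᴴ * A * U) * D * (Vᴴ * B * V)ᵀ).trace := by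
    rw [h]
    simp only [Matrix.conjTranspose_mul, Matrix.transpose_mul, hDD, Matrix.mul_assoc]
    rw [Matrix.trace_mul_comm]
    simp only [Matrix.mul_assoc]
    rfl
  rw [e1, e2, Matrix.trace]
  refine Finset.sum_congr rfl fun i _ => ?_
  rw [Matrix.diag_apply, Matrix.mul_apply]
  refine Finset.sum_congr rfl fun j _ => ?_
  rw [hD, Matrix.mul_diagonal, Matrix.diagonal_mul, Matrix.transpose_apply]
  ring

theorem pure_bound {d r : ℕ} (ψ : Fin d × Fin d → ℂ)
    (h1 : ∑ ij, Complex.normSq (ψ ij) = 1) (hr : (assocMatrix ψ).rank ≤ r)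
    {G H : Fin (d ^ 2) → Matrix (Fin d) (Fin d) ℂ}
    (hG : IsHermitianONB d G) (hH : IsHermitianONB d H) :
    ∃ (P : ℝ) (a b c : Fin (d ^ 2) → ℝ),
      (∀ μ, a μ = (Matrix.vecMulVec ψ (star ψ) * (G μ ⊗ₖ (1 : Matrix (Fin d) (Fin d) ℂ))).trace.re) ∧
      (∀ μ, b μ = (Matrix.vecMulVec ψ (star ψ) * ((1 : Matrix (Fin d) (Fin d) ℂ) ⊗ₖ H μ)).trace.re) ∧
      (∀ μ, c μ = (Matrix.vecMulVec ψ (star ψ) * (G μ ⊗ₖ H μ)).trace.re) ∧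
      P ≤ 1 ∧ ∑ μ, a μ ^ 2 = P ∧ ∑ μ, b μ ^ 2 = P ∧ ∑ μ, |c μ - a μ * b μ| ≤ r - P := by
  obtain ⟨U, V, s, hU, hV, hs, hcard, hM⟩ := svd_ex (assocMatrix ψ)
  have hU' : Uᴴ * U = 1 := mul_eq_one_comm.1 hU
  have hV' : Vᴴ * V = 1 := mul_eq_one_comm.1 hV
  have hT := pure_trace ψ U V s hM
  have hn : ∑ i, s i ^ 2 = 1 := by
    have := congrArg Complex.re (hT 1 1)
    rw [Matrix.one_kronecker_one, Matrix.mul_one, Matrix.trace_vecMulVec, Matrix.mul_one,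
      Matrix.mul_one, hU', hV'] at this
    rw [← h1]
    have e : (ψ ⬝ᵥ star ψ).re = ∑ ij, Complex.normSq (ψ ij) := by
      simp only [dotProduct, Complex.re_sum]
      exact Finset.sum_congr rfl fun ij _ => by simp [Complex.normSq_apply]
    rw [← e, this]
    simp [Matrix.one_apply, Complex.re_sum, sq]
  have hG' := onb_conj hG U hU
  have hH' := onb_conj hH V hV
  set G' := fun μ => Uᴴ * G μ * U with hGd
  set H' := fun μ => Vᴴ * H μ * V with hHd
  refine ⟨∑ i, (s i ^ 2) ^ 2, fun μ => ∑ i, s i ^ 2 * (G' μ i i).re,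
    fun μ => ∑ i, s i ^ 2 * (H' μ i i).re,
    fun μ => ∑ i, ∑ j, s i * s j * (G' μ i j * H' μ i j).re, ?_, ?_, ?_, ?_, ?_, ?_, ?_⟩
  · intro μ
    rw [hT, Matrix.mul_one, hV']
    simp only [Matrix.one_apply, Complex.re_sum]
    refine Finset.sum_congr rfl fun i _ => ?_
    rw [Finset.sum_eq_single i (by intro j _ hj; simp [hj.symm]) (by simp)]
    simp [hGd, sq, ← Complex.ofReal_mul]
  · intro μ
    rw [hT, Matrix.mul_one, hU']
    simp only [Matrix.one_apply, Complex.re_sum]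
    refine Finset.sum_congr rfl fun i _ => ?_
    rw [Finset.sum_eq_single i (by intro j _ hj; simp [hj.symm]) (by simp)]
    simp [hHd, sq, ← Complex.ofReal_mul]
  · intro μ
    rw [hT]
    simp only [Complex.re_sum]
    refine Finset.sum_congr rfl fun i _ => Finset.sum_congr rfl fun j _ => ?_
    rw [← Complex.ofReal_mul, Complex.re_ofReal_mul]
  · rw [← hn]
    refine Finset.sum_le_sum fun i _ => ?_
    have : s i ^ 2 ≤ 1 := by
      rw [← hn]
      exact Finset.single_le_sum (f := fun i => s i ^ 2) (fun j _ => sq_nonneg _)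
        (Finset.mem_univ i)
    nlinarith [sq_nonneg (s i)]
  · exact onb_diag hG' _
  · exact onb_diag hH' _
  · have hq : ∀ {K : Fin (d ^ 2) → Matrix (Fin d) (Fin d) ℂ}, IsHermitianONB d K →
        ∑ μ, ((∑ i, ∑ j, s i * s j * Complex.normSq (K μ i j)) -
          (∑ i, s i ^ 2 * (K μ i i).re) ^ 2) = (∑ i, s i) ^ 2 - ∑ i, (s i ^ 2) ^ 2 := by
      intro K hK
      rw [Finset.sum_sub_distrib, onb_diag hK, sq (∑ i, s i), Finset.sum_mul_sum]
      congr 1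
      rw [Finset.sum_comm]
      refine Finset.sum_congr rfl fun i _ => ?_
      rw [Finset.sum_comm]
      refine Finset.sum_congr rfl fun j _ => ?_
      rw [← Finset.mul_sum, onb_normSq hK, mul_one]
    have hsum : (∑ i, s i) ^ 2 ≤ r := by
      have e : ∑ i, s i = ∑ i ∈ Finset.univ.filter (fun i => s i ≠ 0), s i :=
        (Finset.sum_filter_ne_zero _).symm
      rw [e]
      refine (sq_sum_le_card_mul_sum_sq).trans ?_
      rw [hcard]
      have e2 : ∑ i ∈ Finset.univ.filter (fun i => s i ≠ 0), s i ^ 2 ≤ 1 := by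
        rw [← hn]
        exact Finset.sum_le_sum_of_subset_of_nonneg (Finset.subset_univ _)
          fun _ _ _ => sq_nonneg _
      have e3 : ((assocMatrix ψ).rank : ℝ) ≤ r := by exact_mod_cast hr
      have e4 : (0 : ℝ) ≤ (assocMatrix ψ).rank := Nat.cast_nonneg _
      nlinarith
    have := Finset.sum_le_sum fun μ (_ : μ ∈ Finset.univ) =>
      diag_bound s hs hn (G' μ) (H' μ) (hH'.1 μ)
    rw [← Finset.sum_div, Finset.sum_add_distrib, hq hG', hq hH'] at this
    linarith

theorem stmt_0 (d r : ℕ) (hd : 1 ≤ d) (hr : 1 ≤ r)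
    (ρ : Matrix (Fin d × Fin d) (Fin d × Fin d) ℂ)
    (hρ : IsDensityMatrix ρ) (hSN : SchmidtNumberLE d r ρ)
    (G H : Fin (d ^ 2) → Matrix (Fin d) (Fin d) ℂ)
    (hG : IsHermitianONB d G) (hH : IsHermitianONB d H)
    (a b X : Fin (d ^ 2) → ℝ)
    (ha : ∀ μ, a μ = (ρ * (G μ ⊗ₖ (1 : Matrix (Fin d) (Fin d) ℂ))).trace.re)
    (hb : ∀ μ, b μ = (ρ * ((1 : Matrix (Fin d) (Fin d) ℂ) ⊗ₖ H μ)).trace.re)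
    (hX : ∀ μ, X μ = (ρ * (G μ ⊗ₖ H μ)).trace.re - a μ * b μ) :
    ∑ μ, |X μ| -
      Real.sqrt ((1 - ∑ μ, (a μ) ^ 2) * (1 - ∑ μ, (b μ) ^ 2)) + 1 ≤ (r : ℝ) := by

  obtain ⟨K, p, ψ, hp, hp1, hψ, hrk, hρe⟩ := hSN
  choose P a' b' c' ha' hb' hc' hP hA hB hC using fun k => pure_bound (ψ k) (hψ k) (hrk k) hG hH
  have lin : ∀ Z : Matrix (Fin d × Fin d) (Fin d × Fin d) ℂ, (ρ * Z).trace.re =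
      ∑ k, p k * (Matrix.vecMulVec (ψ k) (star (ψ k)) * Z).trace.re := by
    intro Z
    rw [hρe, Matrix.sum_mul, Matrix.trace_sum, Complex.re_sum]
    refine Finset.sum_congr rfl fun k _ => ?_
    rw [Matrix.smul_mul, Matrix.trace_smul, smul_eq_mul, Complex.re_ofReal_mul]
  have ha2 : ∀ μ, a μ = ∑ k, p k * a' k μ := fun μ => by rw [ha, lin]; simp only [ha']
  have hb2 : ∀ μ, b μ = ∑ k, p k * b' k μ := fun μ => by rw [hb, lin]; simp only [hb']
  have hX2 : ∀ μ, X μ = ∑ k, p k * c' k μ - a μ * b μ := fun μ => by rw [hX, lin]; simp only [hc']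
  have hXe : ∀ μ, X μ = ∑ k, (p k * (c' k μ - a' k μ * b' k μ) +
      p k * ((a' k μ - a μ) * (b' k μ - b μ))) := by
    intro μ
    have : ∀ k, p k * (c' k μ - a' k μ * b' k μ) + p k * ((a' k μ - a μ) * (b' k μ - b μ)) =
      p k * c' k μ - a μ * (p k * b' k μ) - b μ * (p k * a' k μ) + p k * (a μ * b μ) := by
      intro k; ring
    simp only [this, Finset.sum_add_distrib, Finset.sum_sub_distrib, ← Finset.mul_sum,
      ← Finset.sum_mul, ← ha2, ← hb2, hp1, hX2]
    ring
  have hvar : ∀ (x : Fin (d ^ 2) → ℝ) (x' : Fin K → Fin (d ^ 2) → ℝ),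
      (∀ μ, x μ = ∑ k, p k * x' k μ) → (∀ k, ∑ μ, x' k μ ^ 2 = P k) →
      ∑ μ, ∑ k, p k * (x' k μ - x μ) ^ 2 = ∑ k, p k * P k - ∑ μ, x μ ^ 2 := by
    intro x x' hx hx'
    have e : ∀ μ, ∑ k, p k * (x' k μ - x μ) ^ 2 = ∑ k, p k * x' k μ ^ 2 - x μ ^ 2 := by
      intro μ
      have : ∀ k, p k * (x' k μ - x μ) ^ 2 =
          p k * x' k μ ^ 2 - 2 * x μ * (p k * x' k μ) + p k * x μ ^ 2 := by intro k; ring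
      simp only [this, Finset.sum_add_distrib, Finset.sum_sub_distrib, ← Finset.mul_sum,
        ← Finset.sum_mul, ← hx, hp1]
      ring
    simp only [e, Finset.sum_sub_distrib]
    rw [Finset.sum_comm]
    simp only [← Finset.mul_sum, hx']
  have hu := hvar a a' ha2 hA
  have hv := hvar b b' hb2 hB
  set Q := ∑ k, p k * P k with hQ
  have hQ1 : Q ≤ 1 := by
    rw [← hp1]
    exact Finset.sum_le_sum fun k _ => by nlinarith [hp k, hP k]
  set w := ∑ μ, ∑ k, p k * (|a' k μ - a μ| * |b' k μ - b μ|) with hw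
  have hw1 : ∑ μ, |X μ| ≤ (r - Q) + w := by
    have h1 : ∑ μ, |X μ| ≤ ∑ μ, ∑ k, p k * |c' k μ - a' k μ * b' k μ| + w := by
      rw [hw, ← Finset.sum_add_distrib]
      refine Finset.sum_le_sum fun μ _ => ?_
      rw [hXe, ← Finset.sum_add_distrib]
      refine (Finset.abs_sum_le_sum_abs _ _).trans (Finset.sum_le_sum fun k _ => ?_)
      refine (abs_add_le _ _).trans (le_of_eq ?_)
      rw [abs_mul, abs_mul, abs_mul, abs_of_nonneg (hp k)]
    have h2 : ∑ μ, ∑ k, p k * |c' k μ - a' k μ * b' k μ| ≤ r - Q := by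
      rw [Finset.sum_comm]
      simp only [← Finset.mul_sum]
      calc _ ≤ ∑ k, p k * (r - P k) :=
            Finset.sum_le_sum fun k _ => mul_le_mul_of_nonneg_left (hC k) (hp k)
        _ = r - Q := by
            simp only [mul_sub, Finset.sum_sub_distrib, ← Finset.sum_mul, hp1, one_mul, hQ]
    linarith
  set u := ∑ μ, ∑ k, p k * (a' k μ - a μ) ^ 2 with hud
  set v := ∑ μ, ∑ k, p k * (b' k μ - b μ) ^ 2 with hvd
  have hw2 : 2 * w ≤ u + v := by
    rw [hw, hud, hvd]
    simp only [Finset.mul_sum, ← Finset.sum_add_distrib]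
    refine Finset.sum_le_sum fun μ _ => Finset.sum_le_sum fun k _ => ?_
    rw [← sq_abs (a' k μ - a μ), ← sq_abs (b' k μ - b μ)]
    nlinarith [mul_nonneg (hp k) (sq_nonneg (|a' k μ - a μ| - |b' k μ - b μ|))]
  have hw3 : w ^ 2 ≤ u * v := by
    rw [hw, hud, hvd]
    simp only [← Finset.sum_product']
    refine Finset.sum_sq_le_sum_mul_sum_of_sq_eq_mul _
      (fun x _ => mul_nonneg (hp _) (sq_nonneg _)) (fun x _ => mul_nonneg (hp _) (sq_nonneg _))
      fun x _ => ?_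
    rw [← sq_abs (a' x.2 x.1 - a x.1), ← sq_abs (b' x.2 x.1 - b x.1)]
    ring
  have hfin : (1 - Q) + w ≤ Real.sqrt ((1 - ∑ μ, (a μ) ^ 2) * (1 - ∑ μ, (b μ) ^ 2)) := by
    apply Real.le_sqrt_of_sq_le
    have e1 : 1 - ∑ μ, (a μ) ^ 2 = (1 - Q) + u := by linarith
    have e2 : 1 - ∑ μ, (b μ) ^ 2 = (1 - Q) + v := by linarith
    rw [e1, e2]
    nlinarith [mul_le_mul_of_nonneg_left hw2 (sub_nonneg.2 hQ1)]
  linarith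
end

section
/- Let r ≥ 1 and let λ : Fin r → ℝ satisfy λ_n ≥ 0 for all n and Σ_n λ_n = 1. Define the matrix X indexed by (Fin r × Fin r) × (Fin r × Fin r) with entries X (n,m) (n',m') = √(λ_n · λ_m) · (if m = n' ∧ n = m' then 1 else 0) − λ_n · λ_{n'} · (if n = m then 1 else 0) · (if n' = m' then 1 else 0). Then X is a real symmetric (hence Hermitian) matrix, and the sum of the absolute values of its eigenvalues equals Σ_{n,m} √(λ_n · λ_m) − Σ_n λ_n². -/
open Matrix BigOperators

open scoped MatrixOrder Matrix.Norms.L2Operator in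
theorem aux_trace {n : Type*} [Fintype n] [DecidableEq n] (X P : Matrix n n ℝ)
    (hX : X.IsHermitian) (hP : P.PosSemidef) (h : X * X = P * P) :
    ∑ i, |hX.eigenvalues i| = P.trace := by
  set φ := Unitary.conjStarAlgAut ℝ (Matrix n n ℝ) hX.eigenvectorUnitary with hφ
  set D : Matrix n n ℝ := diagonal (fun i => |hX.eigenvalues i|) with hD
  have hDp : D.PosSemidef := PosSemidef.diagonal (fun i => abs_nonneg _)
  have hQ : (φ D).PosSemidef := by
    rw [hφ, Unitary.conjStarAlgAut_apply]
    exact hDp.mul_mul_conjTranspose_same _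
  have hsp : X = φ (diagonal hX.eigenvalues) := hX.spectral_theorem
  have hsq : φ D * φ D = P * P := by
    rw [← h]
    conv_rhs => rw [hsp]
    rw [← map_mul, ← map_mul, hD, diagonal_mul_diagonal, diagonal_mul_diagonal]
    simp only [abs_mul_abs_self]
  have e : φ D = P := by
    rw [← CFC.sqrt_mul_self (φ D) hQ.nonneg, hsq, CFC.sqrt_mul_self P hP.nonneg]
  rw [← e, hφ, Unitary.conjStarAlgAut_apply, trace_mul_comm, ← mul_assoc]
  simp [hD, trace_diagonal]

theorem stmt_2 (r : ℕ) (hr : 1 ≤ r) (lam : Fin r → ℝ)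
    (hnonneg : ∀ n, 0 ≤ lam n) (hsum : ∑ n, lam n = 1)
    (X : Matrix (Fin r × Fin r) (Fin r × Fin r) ℝ)
    (hXdef : X = Matrix.of fun p q =>
      Real.sqrt (lam p.1 * lam p.2) * (if p.2 = q.1 ∧ p.1 = q.2 then 1 else 0) -
        lam p.1 * lam q.1 * (if p.1 = p.2 then 1 else 0) * (if q.1 = q.2 then 1 else 0)) :
    X.IsHermitian ∧
      ∀ hX : X.IsHermitian,
        ∑ μ, |hX.eigenvalues μ| =
          (∑ n, ∑ m, Real.sqrt (lam n * lam m)) - ∑ n, (lam n) ^ 2 := by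
  set v : Fin r × Fin r → ℝ := fun p => if p.1 = p.2 then lam p.1 else 0 with hv
  set d : Fin r × Fin r → ℝ := fun p => Real.sqrt (lam p.1 * lam p.2) with hd
  set P : Matrix (Fin r × Fin r) (Fin r × Fin r) ℝ := diagonal d - vecMulVec v v with hPd
  have hX1 : ∀ p q, X p q = P p q.swap := by
    rintro ⟨a, b⟩ ⟨c, e⟩
    simp only [hXdef, hPd, hv, hd, of_apply, Matrix.sub_apply, diagonal_apply, vecMulVec_apply,
      Prod.swap, Prod.mk.injEq]
    congr 1
    · simp [and_comm]
    · by_cases h1 : a = b <;> by_cases h2 : c = e <;> simp [h1, h2, eq_comm (a := e), eq_comm (a := b)]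
  have hX2 : ∀ p q, X p q = P p.swap q := by
    rintro ⟨a, b⟩ ⟨c, e⟩
    simp only [hXdef, hPd, hv, hd, of_apply, Matrix.sub_apply, diagonal_apply, vecMulVec_apply,
      Prod.swap, Prod.mk.injEq]
    congr 1
    · simp [mul_comm]
    · by_cases h1 : a = b <;> by_cases h2 : c = e <;> simp [h1, h2, eq_comm (a := e), eq_comm (a := b)]
  have hPs : ∀ p q, P p q = P q p := by
    intro p q
    simp only [hPd, Matrix.sub_apply, diagonal_apply, vecMulVec_apply, mul_comm (v p) (v q)]
    by_cases h : p = q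
    · simp [h]
    · simp [h, Ne.symm h]
  have hP : P.PosSemidef := by
    refine PosSemidef.of_dotProduct_mulVec_nonneg ?_ ?_
    · ext p q
      simp [hPs p q]
    · intro x
      have e1 : star x ⬝ᵥ (P *ᵥ x) = ∑ p, d p * x p ^ 2 - (∑ p, v p * x p) ^ 2 := by
        rw [hPd, sub_mulVec, dotProduct_sub]
        congr 1
        · simp only [dotProduct, mulVec_diagonal]
          exact Finset.sum_congr rfl fun p _ => by simp; ring
        · rw [vecMulVec_mulVec]
          simp only [dotProduct, sq, Finset.sum_mul]
          exact Finset.sum_congr rfl fun p _ => by simp; ring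
      have e2 : ∑ p, v p * x p = ∑ n, lam n * x (n, n) := by
        simp [hv, Fintype.sum_prod_type]
      have e3 : ∑ n, lam n * x (n, n) ^ 2 ≤ ∑ p, d p * x p ^ 2 := by
        rw [Fintype.sum_prod_type]
        refine Finset.sum_le_sum fun n _ => ?_
        have := Finset.single_le_sum (f := fun m => d (n, m) * x (n, m) ^ 2)
          (fun m _ => mul_nonneg (Real.sqrt_nonneg _) (sq_nonneg _)) (Finset.mem_univ n)
        simpa [hd, Real.sqrt_mul_self (hnonneg n)] using this
      have e4 := Finset.sum_sq_le_sum_mul_sum_of_sq_eq_mul Finset.univ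
        (r := fun n => lam n * x (n, n)) (f := lam) (g := fun n => lam n * x (n, n) ^ 2)
        (fun n _ => hnonneg n) (fun n _ => mul_nonneg (hnonneg n) (sq_nonneg _))
        (fun n _ => by ring)
      rw [hsum, one_mul] at e4
      rw [e1, e2]
      linarith
  refine ⟨?_, fun hX => ?_⟩
  · ext p q
    rw [conjTranspose_apply, hX1, hX2, hPs]
    simp
  · rw [aux_trace X P hX hP]
    · rw [hPd, trace_sub, trace_diagonal, Fintype.sum_prod_type]
      congr 1
      simp [trace, vecMulVec_apply, hv, Fintype.sum_prod_type, sq]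
    · ext p q
      rw [mul_apply, mul_apply, ← (Equiv.prodComm (Fin r) (Fin r)).sum_comp]
      refine Finset.sum_congr rfl fun k _ => ?_
      rw [hX1, hX2]
      simp
end

section
/- Let r ≥ 1 and let λ : Fin r → ℝ satisfy λ_n ≥ 0 for all n. Define the matrix C indexed by (Fin r × Fin r) × (Fin r × Fin r) with entries C (n,m) (n',m') = √(λ_n · λ_m) if m = n' and n = m', and C (n,m) (n',m') = 0 otherwise. Then C is a real symmetric (hence Hermitian) matrix and the sum of the absolute values of its eigenvalues equals (Σ_n √λ_n)². -/
open Matrix BigOperators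

theorem stmt_7 (r : ℕ) (hr : 1 ≤ r) (lam : Fin r → ℝ)
    (hnonneg : ∀ n, 0 ≤ lam n)
    (C : Matrix (Fin r × Fin r) (Fin r × Fin r) ℝ)
    (hCdef : C = Matrix.of fun p q =>
      if p.2 = q.1 ∧ p.1 = q.2 then Real.sqrt (lam p.1 * lam p.2) else 0) :
    C.IsHermitian ∧
      ∀ hC : C.IsHermitian,
        ∑ μ, |hC.eigenvalues μ| = (∑ n, Real.sqrt (lam n)) ^ 2 := by
  constructor
  · ext ⟨a, b⟩ ⟨c, d⟩
    rw [hCdef]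
    simp only [conjTranspose_apply, of_apply, star_trivial]
    by_cases h : b = c ∧ a = d
    · obtain ⟨rfl, rfl⟩ := h
      simp [mul_comm]
    · rw [if_neg h, if_neg]
      rintro ⟨rfl, rfl⟩
      exact h ⟨rfl, rfl⟩
  · intro hC
    have hsq : C * C = diagonal (fun p : Fin r × Fin r => lam p.1 * lam p.2) := by
      ext ⟨a, b⟩ ⟨c, d⟩
      rw [mul_apply, Finset.sum_eq_single (b, a)]
      · rw [hCdef]
        by_cases h : a = c ∧ b = d
        · obtain ⟨rfl, rfl⟩ := h
          simp only [of_apply, diagonal_apply_eq, and_self, if_true]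
          rw [mul_comm (lam b)]
          exact Real.mul_self_sqrt (mul_nonneg (hnonneg _) (hnonneg _))
        · rw [diagonal_apply_ne _ (by simpa using h)]
          simp [h]
      · rintro ⟨e, f⟩ _ h
        rw [hCdef]
        have : ¬ (b = e ∧ a = f) := by
          rintro ⟨rfl, rfl⟩; exact h rfl
        simp [this]
      · simp
    have h1 : (C * C).charpoly
        = ∏ i, (Polynomial.X - Polynomial.C (hC.eigenvalues i * hC.eigenvalues i)) := by
      have : C * C = Unitary.conjStarAlgAut ℝ _ hC.eigenvectorUnitary
          (diagonal fun i => hC.eigenvalues i * hC.eigenvalues i) := by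
        rw [← diagonal_mul_diagonal, map_mul]
        have := hC.spectral_theorem
        simp only [RCLike.ofReal_real_eq_id, Function.id_comp] at this
        rw [← this]
      rw [this, Unitary.conjStarAlgAut_apply, charpoly_mul_comm, ← mul_assoc]
      simp [charpoly_diagonal]
    rw [hsq, charpoly_diagonal] at h1
    have h2 := congrArg Polynomial.roots h1
    rw [Polynomial.roots_prod _ _ (by
        simp only [Finset.prod_ne_zero_iff]
        exact fun _ _ => Polynomial.X_sub_C_ne_zero _),
      Polynomial.roots_prod _ _ (by
        simp only [Finset.prod_ne_zero_iff]
        exact fun _ _ => Polynomial.X_sub_C_ne_zero _)] at h2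
    simp only [Polynomial.roots_X_sub_C, Multiset.bind_singleton] at h2
    have h3 := congrArg (fun s => (s.map Real.sqrt).sum) h2
    simp only [Multiset.map_map, Function.comp_def, Real.sqrt_mul_self_eq_abs] at h3
    change ∑ p : Fin r × Fin r, Real.sqrt (lam p.1 * lam p.2) = ∑ i, |hC.eigenvalues i| at h3
    rw [← h3, sq, Finset.sum_mul_sum, Fintype.sum_prod_type]
    simp only [Real.sqrt_mul (hnonneg _)]
end

section
/- Let A be a d_A × d_A Hermitian matrix and B a d_B × d_B Hermitian matrix, let K ≥ 1, let σ_k (k ∈ Fin K) be density matrices on ℂ^{d_A} ⊗ ℂ^{d_B} (positive semidefinite matrices indexed by Fin d_A × Fin d_B with trace 1), let p_k ≥ 0 with Σ_k p_k = 1, and set ρ = Σ_k p_k σ_k. For a density matrix τ define v_A(τ) = Re tr(τ (A² ⊗ I)) − (Re tr(τ (A ⊗ I)))², v_B(τ) = Re tr(τ (I ⊗ B²)) − (Re tr(τ (I ⊗ B)))², and c(τ) = Re tr(τ (A ⊗ B)) − Re tr(τ (A ⊗ I)) · Re tr(τ (I ⊗ B)). Then (c(ρ) − Σ_k p_k c(σ_k))²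 ≤ (v_A(ρ) − Σ_k p_k v_A(σ_k)) · (v_B(ρ) − Σ_k p_k v_B(σ_k)). -/
open Matrix Kronecker BigOperators
open scoped ComplexOrder

theorem cov_cs {K : ℕ} (p a b : Fin K → ℝ) (hp : ∀ k, 0 ≤ p k) (hs : ∑ k, p k = 1) :
    (∑ k, p k * (a k * b k) - (∑ k, p k * a k) * (∑ k, p k * b k)) ^ 2 ≤
      (∑ k, p k * (a k) ^ 2 - (∑ k, p k * a k) ^ 2) *
      (∑ k, p k * (b k) ^ 2 - (∑ k, p k * b k) ^ 2) := by
  have key : ∀ x y : Fin K → ℝ, ∑ k, p k * (x k * y k) - (∑ k, p k * x k) * (∑ k, p k * y k)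
      = ∑ k, p k * ((x k - ∑ j, p j * x j) * (y k - ∑ j, p j * y j)) := by
    intro x y
    generalize hX : ∑ j, p j * x j = X
    generalize hY : ∑ j, p j * y j = Y
    have h : ∀ k, p k * ((x k - X) * (y k - Y))
        = p k * (x k * y k) - Y * (p k * x k) - X * (p k * y k) + X * Y * p k := by
      intro k; ring
    simp only [h, Finset.sum_add_distrib, Finset.sum_sub_distrib, ← Finset.mul_sum, hX, hY, hs]
    ring
  have h1 := key a a
  have h2 := key b b
  simp only [← pow_two] at h1 h2
  rw [key a b, h1, h2]
  apply Finset.sum_sq_le_sum_mul_sum_of_sq_eq_mul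
  · intro k _; exact mul_nonneg (hp k) (sq_nonneg _)
  · intro k _; exact mul_nonneg (hp k) (sq_nonneg _)
  · intro k _; ring

theorem stmt_9 (dA dB K : ℕ) (hK : 1 ≤ K)
    (A : Matrix (Fin dA) (Fin dA) ℂ) (hA : A.IsHermitian)
    (B : Matrix (Fin dB) (Fin dB) ℂ) (hB : B.IsHermitian)
    (σ : Fin K → Matrix (Fin dA × Fin dB) (Fin dA × Fin dB) ℂ)
    (hσ : ∀ k, IsDensityMatrix (σ k))
    (p : Fin K → ℝ) (hp : ∀ k, 0 ≤ p k) (hpsum : ∑ k, p k = 1)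
    (ρ : Matrix (Fin dA × Fin dB) (Fin dA × Fin dB) ℂ)
    (hρ : ρ = ∑ k, (p k : ℂ) • σ k)
    (vA vB c : Matrix (Fin dA × Fin dB) (Fin dA × Fin dB) ℂ → ℝ)
    (hvA : ∀ τ, vA τ = (τ * ((A * A) ⊗ₖ (1 : Matrix (Fin dB) (Fin dB) ℂ))).trace.re -
      ((τ * (A ⊗ₖ (1 : Matrix (Fin dB) (Fin dB) ℂ))).trace.re) ^ 2)
    (hvB : ∀ τ, vB τ = (τ * ((1 : Matrix (Fin dA) (Fin dA) ℂ) ⊗ₖ (B * B))).trace.re -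
      ((τ * ((1 : Matrix (Fin dA) (Fin dA) ℂ) ⊗ₖ B)).trace.re) ^ 2)
    (hc : ∀ τ, c τ = (τ * (A ⊗ₖ B)).trace.re -
      (τ * (A ⊗ₖ (1 : Matrix (Fin dB) (Fin dB) ℂ))).trace.re *
        (τ * ((1 : Matrix (Fin dA) (Fin dA) ℂ) ⊗ₖ B)).trace.re) :
    (c ρ - ∑ k, p k * c (σ k)) ^ 2 ≤
      (vA ρ - ∑ k, p k * vA (σ k)) * (vB ρ - ∑ k, p k * vB (σ k)) := by
  have lin : ∀ M : Matrix (Fin dA × Fin dB) (Fin dA × Fin dB) ℂ,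
      (ρ * M).trace.re = ∑ k, p k * (σ k * M).trace.re := by
    intro M
    rw [hρ, Finset.sum_mul, Matrix.trace_sum, Complex.re_sum]
    refine Finset.sum_congr rfl fun k _ => ?_
    rw [Matrix.smul_mul, Matrix.trace_smul, smul_eq_mul, Complex.re_ofReal_mul]
  have h := cov_cs p (fun k => (σ k * (A ⊗ₖ (1 : Matrix (Fin dB) (Fin dB) ℂ))).trace.re)
    (fun k => (σ k * ((1 : Matrix (Fin dA) (Fin dA) ℂ) ⊗ₖ B)).trace.re) hp hpsum
  simp only [hvA, hvB, hc, lin, mul_sub, Finset.sum_sub_distrib]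
  convert h using 1 <;> ring
end

section
/- Let U be a d_A × d_A unitary complex matrix and V a d_B × d_B unitary complex matrix, and set c = e^{iπ/4} = (1 + i)/√2, M₀ = (1/(2√2))(I ⊗ I − i·c·(U ⊗ I) − conj(c)·(I ⊗ V) − i·(U ⊗ V)) and M₁ = (1/(2√2))(−I ⊗ I + i·c·(U ⊗ I) − conj(c)·(I ⊗ V) − i·(U ⊗ V)). Then M₁ᴴ M₁ − M₀ᴴ M₀ = (1/4)(i·(U ⊗ V) + U ⊗ Vᴴ + Uᴴ ⊗ V − i·(Uᴴ ⊗ Vᴴ)). -/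
open Matrix Kronecker BigOperators

theorem stmt_11 (dA dB : ℕ)
    (U : Matrix (Fin dA) (Fin dA) ℂ) (hU : Uᴴ * U = 1)
    (V : Matrix (Fin dB) (Fin dB) ℂ) (hV : Vᴴ * V = 1)
    (c : ℂ) (hc : c = (1 + Complex.I) / (Real.sqrt 2 : ℂ))
    (M₀ M₁ : Matrix (Fin dA × Fin dB) (Fin dA × Fin dB) ℂ)
    (hM₀ : M₀ = ((1 : ℂ) / (2 * (Real.sqrt 2 : ℂ))) •
      ((1 : Matrix (Fin dA) (Fin dA) ℂ) ⊗ₖ (1 : Matrix (Fin dB) (Fin dB) ℂ)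
        - (Complex.I * c) • (U ⊗ₖ (1 : Matrix (Fin dB) (Fin dB) ℂ))
        - (starRingEnd ℂ c) • ((1 : Matrix (Fin dA) (Fin dA) ℂ) ⊗ₖ V)
        - Complex.I • (U ⊗ₖ V)))
    (hM₁ : M₁ = ((1 : ℂ) / (2 * (Real.sqrt 2 : ℂ))) •
      (-((1 : Matrix (Fin dA) (Fin dA) ℂ) ⊗ₖ (1 : Matrix (Fin dB) (Fin dB) ℂ))
        + (Complex.I * c) • (U ⊗ₖ (1 : Matrix (Fin dB) (Fin dB) ℂ))
        - (starRingEnd ℂ c) • ((1 : Matrix (Fin dA) (Fin dA) ℂ) ⊗ₖ V)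
        - Complex.I • (U ⊗ₖ V))) :
    M₁ᴴ * M₁ - M₀ᴴ * M₀ = ((1 : ℂ) / 4) •
      (Complex.I • (U ⊗ₖ V) + U ⊗ₖ Vᴴ + Uᴴ ⊗ₖ V - Complex.I • (Uᴴ ⊗ₖ Vᴴ)) := by
  have hs : ((Real.sqrt 2 : ℝ) : ℂ) * (Real.sqrt 2 : ℝ) = 2 := by
    rw [← Complex.ofReal_mul, Real.mul_self_sqrt (by norm_num)]; norm_num
  have hs0 : ((Real.sqrt 2 : ℝ) : ℂ) ≠ 0 := by
    intro h; rw [h] at hs; norm_num at hs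
  have hcc : (starRingEnd ℂ c) * (starRingEnd ℂ c) = -Complex.I := by
    rw [hc]
    simp only [map_div₀, map_add, map_one, Complex.conj_I, Complex.conj_ofReal]
    rw [div_mul_div_comm, hs]
    linear_combination (1/2 : ℂ) * Complex.I_mul_I
  obtain ⟨P, hP⟩ : ∃ P, P = (1 : Matrix (Fin dA) (Fin dA) ℂ) ⊗ₖ (1 : Matrix (Fin dB) (Fin dB) ℂ)
        - (Complex.I * c) • (U ⊗ₖ (1 : Matrix (Fin dB) (Fin dB) ℂ)) := ⟨_, rfl⟩
  obtain ⟨Q, hQ⟩ : ∃ Q, Q = -((starRingEnd ℂ c) • ((1 : Matrix (Fin dA) (Fin dA) ℂ) ⊗ₖ V))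
        - Complex.I • (U ⊗ₖ V) := ⟨_, rfl⟩
  have h1 : Pᴴ * Q = -(Complex.I • (U ⊗ₖ V)) - Uᴴ ⊗ₖ V := by
    rw [hP, hQ]
    simp only [conjTranspose_sub, conjTranspose_smul, conjTranspose_kronecker, conjTranspose_one,
      sub_mul, mul_sub, mul_neg, smul_mul_assoc, mul_smul_comm, ← mul_kronecker_mul, one_mul,
      mul_one, hU, ← starRingEnd_apply]
    simp only [map_mul, Complex.conj_I, smul_sub, smul_neg, smul_smul]
    have e1 : starRingEnd ℂ c * (-Complex.I * starRingEnd ℂ c) = -1 := by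
      linear_combination (-Complex.I) * hcc + Complex.I_mul_I
    have e2 : Complex.I * (-Complex.I * starRingEnd ℂ c) = starRingEnd ℂ c := by
      linear_combination (-starRingEnd ℂ c) * Complex.I_mul_I
    have e1' : -Complex.I * starRingEnd ℂ c * starRingEnd ℂ c = -1 := by
      linear_combination e1
    have e2' : -Complex.I * starRingEnd ℂ c * Complex.I = starRingEnd ℂ c := by
      linear_combination e2
    simp only [e1, e2, e1', e2']
    module
  have h2 : Qᴴ * P = Complex.I • (Uᴴ ⊗ₖ Vᴴ) - U ⊗ₖ Vᴴ := by
    have := congrArg conjTranspose h1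
    rw [conjTranspose_mul, conjTranspose_conjTranspose] at this
    rw [this]
    simp [conjTranspose_kronecker]
  have k0 : M₀ = ((1 : ℂ) / (2 * (Real.sqrt 2 : ℂ))) • (P + Q) := by
    rw [hM₀, hP, hQ]; module
  have k1 : M₁ = ((1 : ℂ) / (2 * (Real.sqrt 2 : ℂ))) • (Q - P) := by
    rw [hM₁, hP, hQ]; module
  have hss : star ((1 : ℂ) / (2 * (Real.sqrt 2 : ℂ))) * ((1 : ℂ) / (2 * (Real.sqrt 2 : ℂ)))
      = 1 / 8 := by
    rw [← starRingEnd_apply]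
    simp only [map_div₀, map_mul, map_one, Complex.conj_ofReal, map_ofNat]
    rw [div_mul_div_comm]
    congr 1
    · norm_num
    · linear_combination 4 * hs
  have k : M₁ᴴ * M₁ - M₀ᴴ * M₀ = ((1 : ℂ) / 4) • (-(Pᴴ * Q) - Qᴴ * P) := by
    rw [k0, k1]
    simp only [conjTranspose_smul, smul_mul_assoc, mul_smul_comm, smul_smul]
    rw [mul_comm, hss]
    simp only [conjTranspose_add, conjTranspose_sub, add_mul, mul_add, sub_mul, mul_sub]
    module
  rw [k, h1, h2]
  module
end

section
/- Let d, r ≥ 1, let ρ be a density matrix on ℂ^d ⊗ ℂ^d with Schmidt number at most r, and let T be a d × d complex matrix with Frobenius norm 1; let Ψ_T : Fin d × Fin d → ℂ be the unit vector Ψ_T (i,j) = T i j, and let λ_1 ≥ λ_2 ≥ … ≥ λ_d be the eigenvalues of Tᴴ T arranged in non-increasing order. Then Re⟨Ψ_T, ρ Ψ_T⟩ ≤ Σ_{k=1}^{min(r,d)} λ_k, i.e. the fidelity of ρ with the target state Ψ_T is at most the sum of the min(r,d) largest squared Schmidt coefficients of Ψ_T. -/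
open Matrix BigOperators
open scoped ComplexOrder

lemma aux_rearr (d m : ℕ) (hm : 1 ≤ m) (hmd : m ≤ d) (lam w : Fin d → ℝ) (hanti : Antitone lam)
    (h0 : ∀ k, 0 ≤ lam k) (hw0 : ∀ k, 0 ≤ w k) (hw1 : ∀ k, w k ≤ 1) (hs : ∑ k, w k ≤ m) :
    ∑ k, lam k * w k ≤ ∑ k : Fin d, if (k : ℕ) < m then lam k else 0 := by
  set c := lam ⟨m - 1, by omega⟩ with hc
  have hc0 : 0 ≤ c := h0 _
  have hcard : ∑ k : Fin d, (if (k : ℕ) < m then (1 : ℝ) else 0) = m := by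
    rw [Finset.sum_boole]
    congr 1
    rw [Fin.card_filter_val_lt]
    omega
  have hterm : ∀ k : Fin d, lam k * w k ≤ (if (k : ℕ) < m then lam k else 0)
      + c * (w k - if (k : ℕ) < m then 1 else 0) := by
    intro k
    split_ifs with h
    · have : c ≤ lam k := hanti (Fin.le_def.2 (by simp; omega))
      nlinarith [hw1 k, hw0 k]
    · have : lam k ≤ c := hanti (Fin.le_def.2 (by simp; omega))
      nlinarith [hw1 k, hw0 k]
  have := Finset.sum_le_sum fun k (_ : k ∈ Finset.univ) => hterm k
  rw [Finset.sum_add_distrib, ← Finset.mul_sum, Finset.sum_sub_distrib, hcard] at this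
  nlinarith

abbrev crow {d : ℕ} (M : Matrix (Fin d) (Fin d) ℂ) (i : Fin d) : EuclideanSpace ℂ (Fin d) :=
  WithLp.toLp 2 (star (M i))

lemma aux_inner {d : ℕ} (M : Matrix (Fin d) (Fin d) ℂ) (i : Fin d)
    (x : EuclideanSpace ℂ (Fin d)) : inner ℂ (crow M i) x = (M *ᵥ x.ofLp) i := by
  simp [crow, EuclideanSpace.inner_eq_star_dotProduct, Matrix.mulVec, dotProduct_comm]

lemma aux_quad {d : ℕ} (T : Matrix (Fin d) (Fin d) ℂ) (x : EuclideanSpace ℂ (Fin d)) :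
    ∑ i, ‖inner ℂ (crow T i) x‖ ^ 2 = ∑ k,
      (Matrix.posSemidef_conjTranspose_mul_self T).1.eigenvalues k *
      ‖inner ℂ ((Matrix.posSemidef_conjTranspose_mul_self T).1.eigenvectorBasis k) x‖ ^ 2 := by
  set hA := (Matrix.posSemidef_conjTranspose_mul_self T).1
  have h1 : inner ℂ x (WithLp.toLp 2 ((Tᴴ * T) *ᵥ x.ofLp) : EuclideanSpace ℂ (Fin d))
      = ((∑ i, ‖inner ℂ (crow T i) x‖ ^ 2 : ℝ) : ℂ) := by
    simp only [aux_inner]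
    rw [EuclideanSpace.inner_eq_star_dotProduct, dotProduct_comm, ← Matrix.mulVec_mulVec,
      Matrix.dotProduct_mulVec, ← Matrix.star_mulVec, dotProduct]
    push_cast
    refine Finset.sum_congr rfl fun i _ => ?_
    exact Complex.conj_mul' _
  have h2 : ∀ k, inner ℂ (hA.eigenvectorBasis k)
      (WithLp.toLp 2 ((Tᴴ * T) *ᵥ x.ofLp) : EuclideanSpace ℂ (Fin d))
      = (hA.eigenvalues k : ℂ) * inner ℂ (hA.eigenvectorBasis k) x := by
    intro k
    have h5 : ∀ y : Fin d → ℂ, star y ᵥ* (Tᴴ * T) = star ((Tᴴ * T) *ᵥ y) := fun y => by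
      rw [Matrix.star_mulVec, hA.eq]
    have h3 := hA.mulVec_eigenvectorBasis k
    rw [EuclideanSpace.inner_eq_star_dotProduct, EuclideanSpace.inner_eq_star_dotProduct,
      dotProduct_comm, Matrix.dotProduct_mulVec, h5, h3,
      dotProduct_comm]
    simp [dotProduct, Finset.mul_sum]
    refine Finset.sum_congr rfl fun i _ => by ring
  have h4 := hA.eigenvectorBasis.sum_inner_mul_inner x
    (WithLp.toLp 2 ((Tᴴ * T) *ᵥ x.ofLp) : EuclideanSpace ℂ (Fin d))
  rw [h1] at h4
  simp only [h2] at h4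
  apply Complex.ofReal_injective
  rw [← h4]
  push_cast
  refine Finset.sum_congr rfl fun k _ => ?_
  rw [← inner_conj_symm x, ← Complex.conj_mul']
  ring

lemma aux_rank {d : ℕ} (M : Matrix (Fin d) (Fin d) ℂ) :
    Module.finrank ℂ (Submodule.span ℂ (Set.range (crow M))) = M.rank := by
  rw [← Matrix.rank_conjTranspose, Matrix.rank_eq_finrank_span_cols]
  rw [← LinearEquiv.finrank_map_eq (WithLp.linearEquiv 2 ℂ (Fin d → ℂ)).symm, Submodule.map_span,
    ← Set.range_comp]
  rfl

lemma aux_pure {d r : ℕ} (hd : 1 ≤ d) (hr : 1 ≤ r) (M T : Matrix (Fin d) (Fin d) ℂ)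
    (hM : M.rank ≤ r) (hM1 : ∑ i, ‖crow M i‖ ^ 2 = 1)
    (lam : Fin d → ℝ) (hanti : Antitone lam)
    (e : Fin d ≃ Fin d)
    (hlam : ∀ i, lam i =
      (Matrix.posSemidef_conjTranspose_mul_self T).1.eigenvalues (e i)) :
    ‖∑ i, inner ℂ (crow M i) (crow T i)‖ ^ 2 ≤
      ∑ k : Fin d, if (k : ℕ) < min r d then lam k else 0 := by
  set S := Submodule.span ℂ (Set.range (crow M)) with hS
  have hrk : Module.finrank ℂ S = M.rank := aux_rank M
  let b := stdOrthonormalBasis ℂ S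
  set v := (Matrix.posSemidef_conjTranspose_mul_self T).1.eigenvectorBasis with hv
  have hmS : ∀ i, crow M i ∈ S := fun i => Submodule.subset_span ⟨i, rfl⟩
  have hproj : ∀ i, inner ℂ (crow M i) (crow T i)
      = inner ℂ (⟨crow M i, hmS i⟩ : S) (S.orthogonalProjectionOnto (crow T i)) := by
    intro i
    exact (Submodule.inner_orthogonalProjectionOnto_eq_of_mem_left (⟨crow M i, hmS i⟩ : S) (crow T i)).symm
  have hpn : ∀ x, ‖S.orthogonalProjectionOnto x‖ ^ 2
      = ∑ a, ‖inner ℂ x (b a : EuclideanSpace ℂ (Fin d))‖ ^ 2 := by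
    intro x
    rw [← b.sum_sq_norm_inner_right]
    refine Finset.sum_congr rfl fun a _ => ?_
    rw [Submodule.inner_orthogonalProjectionOnto_eq_of_mem_left, norm_inner_symm]
  have hcs : ‖∑ i, inner ℂ (crow M i) (crow T i)‖ ^ 2
      ≤ ∑ i, ‖S.orthogonalProjectionOnto (crow T i)‖ ^ 2 := by
    have h1 : ‖∑ i, inner ℂ (crow M i) (crow T i)‖
        ≤ ∑ i, ‖crow M i‖ * ‖S.orthogonalProjectionOnto (crow T i)‖ := by
      refine (norm_sum_le _ _).trans (Finset.sum_le_sum fun i _ => ?_)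
      rw [hproj]
      exact norm_inner_le_norm (𝕜 := ℂ) (⟨crow M i, hmS i⟩ : S) (S.orthogonalProjectionOnto (crow T i))
    have h2 := Finset.sum_mul_sq_le_sq_mul_sq Finset.univ (fun i => ‖crow M i‖)
      (fun i => ‖S.orthogonalProjectionOnto (crow T i)‖)
    rw [hM1, one_mul] at h2
    exact (pow_le_pow_left₀ (norm_nonneg _) h1 2).trans h2
  refine hcs.trans ?_
  simp only [hpn]
  rw [Finset.sum_comm]
  simp only [aux_quad]
  rw [Finset.sum_comm]
  simp only [← Finset.mul_sum]
  rw [← hv, ← e.sum_comp]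
  simp only [← hlam]
  apply aux_rearr d (min r d) (by omega) (by omega) lam
    (fun k => ∑ a, ‖inner ℂ (v (e k)) (b a : EuclideanSpace ℂ (Fin d))‖ ^ 2) hanti
  · intro k
    rw [hlam]
    exact (Matrix.posSemidef_conjTranspose_mul_self T).eigenvalues_nonneg _
  · intro k; positivity
  · intro k
    rw [← hpn]
    have := S.norm_orthogonalProjectionOnto_apply_le (v (e k))
    rw [v.norm_eq_one] at this
    exact pow_le_one₀ (norm_nonneg _) this
  · rw [e.sum_comp (fun k => ∑ a, ‖inner ℂ (v k) (b a : EuclideanSpace ℂ (Fin d))‖ ^ 2),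
      Finset.sum_comm]
    simp only [v.sum_sq_norm_inner_right]
    have hb : ∀ a, ‖(b a : EuclideanSpace ℂ (Fin d))‖ = 1 := fun a => b.norm_eq_one a
    simp only [hb]
    simp only [one_pow, Finset.sum_const, Finset.card_univ, Fintype.card_fin, nsmul_eq_mul, mul_one]
    rw [hrk]
    have : M.rank ≤ d := by simpa using M.rank_le_width
    exact_mod_cast le_min hM this

theorem stmt_13 (d r : ℕ) (hd : 1 ≤ d) (hr : 1 ≤ r)
    (ρ : Matrix (Fin d × Fin d) (Fin d × Fin d) ℂ)
    (hρ : IsDensityMatrix ρ) (hSN : SchmidtNumberLE d r ρ)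
    (T : Matrix (Fin d) (Fin d) ℂ)
    (hT : ∑ i, ∑ j, Complex.normSq (T i j) = 1)
    (Ψ : Fin d × Fin d → ℂ) (hΨ : ∀ p, Ψ p = T p.1 p.2)
    (lam : Fin d → ℝ) (hanti : Antitone lam)
    (e : Fin d ≃ Fin d)
    (hlam : ∀ i, lam i =
      (Matrix.posSemidef_conjTranspose_mul_self T).1.eigenvalues (e i)) :
    (star Ψ ⬝ᵥ (ρ *ᵥ Ψ)).re ≤ ∑ k : Fin d, if (k : ℕ) < min r d then lam k else 0 := by
  obtain ⟨K, p, ψ, hp, hp1, hψ, hrank, rfl⟩ := hSN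
  have key : ∀ k, Complex.normSq (star Ψ ⬝ᵥ ψ k) ≤
      ∑ k : Fin d, if (k : ℕ) < min r d then lam k else 0 := by
    intro k
    have h := aux_pure hd hr (assocMatrix (ψ k)) T (hrank k) (by
      rw [← hψ k, Fintype.sum_prod_type]
      simp [EuclideanSpace.norm_sq_eq, assocMatrix, Complex.normSq_eq_norm_sq]) lam hanti e hlam
    rw [Complex.normSq_eq_norm_sq]
    convert h using 3
    rw [dotProduct, Fintype.sum_prod_type]
    refine Finset.sum_congr rfl fun i _ => ?_
    simp [EuclideanSpace.inner_eq_star_dotProduct, dotProduct, assocMatrix, hΨ]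
  have hexp : (star Ψ ⬝ᵥ ((∑ k, (p k : ℂ) • Matrix.vecMulVec (ψ k) (star (ψ k))) *ᵥ Ψ)).re
      = ∑ k, p k * Complex.normSq (star Ψ ⬝ᵥ ψ k) := by
    rw [Matrix.sum_mulVec, dotProduct_sum, Complex.re_sum]
    refine Finset.sum_congr rfl fun k _ => ?_
    have h1 : star (ψ k) ⬝ᵥ Ψ = star (star Ψ ⬝ᵥ ψ k) := by
      rw [Matrix.star_dotProduct]
    rw [Matrix.smul_mulVec, dotProduct_smul, Matrix.vecMulVec_mulVec, h1]
    simp [dotProduct_smul, Complex.normSq_apply]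
  rw [hexp]
  calc _ ≤ ∑ k, p k * _ := Finset.sum_le_sum fun k _ => mul_le_mul_of_nonneg_left (key k) (hp k)
    _ = _ := by rw [← Finset.sum_mul, hp1, one_mul]
end

section
/- Let d, r ≥ 1 and let ρ be a density matrix on ℂ^d ⊗ ℂ^d with Schmidt number at most r. Define the realignment R(ρ), a matrix indexed by (Fin d × Fin d) × (Fin d × Fin d), by R(ρ) (i,j) (k,l) = ρ (i,k) (j,l). Then the trace norm of R(ρ) is at most r: Σ_i √(μ_i) ≤ r, where μ_i are the eigenvalues of R(ρ)ᴴ R(ρ). -/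
open Matrix BigOperators
open scoped ComplexOrder

/-- The realignment map: `R(ρ) (i,j) (k,l) = ρ (i,k) (j,l)`. -/
def realign {d : ℕ} (ρ : Matrix (Fin d × Fin d) (Fin d × Fin d) ℂ) :
    Matrix (Fin d × Fin d) (Fin d × Fin d) ℂ :=
  Matrix.of fun p q => ρ (p.1, q.1) (p.2, q.2)

open scoped InnerProductSpace in
lemma eig_inner {m n : Type*} [Fintype m] [Fintype n] [DecidableEq m] [DecidableEq n]
    (A : Matrix m n ℂ) (hA : (Aᴴ * A).IsHermitian) (i j : n) :
    ⟪Matrix.toEuclideanLin A (hA.eigenvectorBasis i),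
      Matrix.toEuclideanLin A (hA.eigenvectorBasis j)⟫_ℂ
      = if i = j then (hA.eigenvalues j : ℂ) else 0 := by
  have h := hA.mulVec_eigenvectorBasis j
  have h2 := orthonormal_iff_ite.mp hA.eigenvectorBasis.orthonormal i j
  rw [EuclideanSpace.inner_eq_star_dotProduct] at h2 ⊢
  simp only [Matrix.ofLp_toLpLin, Matrix.toLin'_apply]
  rw [Matrix.star_mulVec, dotProduct_comm, ← Matrix.dotProduct_mulVec, Matrix.mulVec_mulVec, h,
    dotProduct_smul, dotProduct_comm, h2]
  split_ifs <;> simp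

lemma eig_norm {m n : Type*} [Fintype m] [Fintype n] [DecidableEq m] [DecidableEq n]
    (A : Matrix m n ℂ) (hA : (Aᴴ * A).IsHermitian) (i : n) :
    ‖Matrix.toEuclideanLin A (hA.eigenvectorBasis i)‖ = Real.sqrt (hA.eigenvalues i) := by
  have h := eig_inner A hA i i
  rw [inner_self_eq_norm_sq_to_K] at h
  simp only [if_true] at h
  have h' : ‖Matrix.toEuclideanLin A (hA.eigenvectorBasis i)‖ ^ 2 = hA.eigenvalues i := by
    exact Complex.ofReal_injective (by simpa using h)
  rw [← h', Real.sqrt_sq (norm_nonneg _)]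

open scoped InnerProductSpace in
lemma trace_norm_le {m n ι : Type*} [Fintype m] [Fintype n] [DecidableEq m] [DecidableEq n]
    [Fintype ι] (A : Matrix m n ℂ) (hA : (Aᴴ * A).IsHermitian)
    (u : ι → EuclideanSpace ℂ m) (v : ι → EuclideanSpace ℂ n)
    (h : ∀ p q, A p q = ∑ a, u a p * star (v a q)) :
    ∑ i, Real.sqrt (hA.eigenvalues i) ≤ ∑ a, ‖u a‖ * ‖v a‖ := by
  classical
  set b := hA.eigenvectorBasis with hb
  set T := Matrix.toEuclideanLin A with hT
  have hTx : ∀ x, T x = ∑ a, ⟪v a, x⟫_ℂ • u a := by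
    intro x
    ext p
    simp only [hT, Matrix.ofLp_toLpLin, Matrix.toLin'_apply, Matrix.mulVec, dotProduct, h,
      WithLp.ofLp_sum, Finset.sum_apply, WithLp.ofLp_smul, Pi.smul_apply, smul_eq_mul,
      PiLp.inner_apply, RCLike.inner_apply, Finset.sum_mul]
    rw [Finset.sum_comm]
    refine Finset.sum_congr rfl fun a _ => Finset.sum_congr rfl fun q _ => ?_
    simp only [RCLike.star_def]
    ring
  let S := {i : n // Real.sqrt (hA.eigenvalues i) ≠ 0}
  let w : S → EuclideanSpace ℂ m := fun i => ((Real.sqrt (hA.eigenvalues i.1) : ℂ)⁻¹) • T (b i.1)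
  have hw : Orthonormal ℂ w := by
    rw [orthonormal_iff_ite]
    rintro ⟨i, hi⟩ ⟨j, hj⟩
    simp only [w, inner_smul_left, inner_smul_right, hT, hb, eig_inner]
    by_cases hij : i = j
    · subst hij
      rw [if_pos rfl, if_pos rfl]
      have h0 : 0 ≤ hA.eigenvalues i := by
        by_contra hc
        exact hi (Real.sqrt_eq_zero_of_nonpos (le_of_not_ge hc))
      have h1 : (hA.eigenvalues i : ℂ) =
          (Real.sqrt (hA.eigenvalues i) : ℂ) * (Real.sqrt (hA.eigenvalues i) : ℂ) := by
        rw [← Complex.ofReal_mul, Real.mul_self_sqrt h0]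
      have h2 : (Real.sqrt (hA.eigenvalues i) : ℂ) ≠ 0 := by exact_mod_cast hi
      rw [map_inv₀, Complex.conj_ofReal, h1]
      field_simp
    · rw [if_neg hij, if_neg (fun h => hij (congrArg Subtype.val h))]
      simp
  have hbS : Orthonormal ℂ (fun i : S => b i.1) :=
    b.orthonormal.comp _ Subtype.val_injective
  have e1 : ∑ i, Real.sqrt (hA.eigenvalues i) = ∑ i : S, Real.sqrt (hA.eigenvalues i.1) := by
    rw [← Finset.sum_filter_ne_zero]
    exact Finset.sum_subtype _ (by simp) _
  have e2 : ∀ i : S, (Real.sqrt (hA.eigenvalues i.1) : ℂ) = ⟪w i, T (b i.1)⟫_ℂ := by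
    rintro ⟨i, hi⟩
    have h2 : (Real.sqrt (hA.eigenvalues i) : ℂ) ≠ 0 := by exact_mod_cast hi
    simp only [w, inner_smul_left]
    rw [inner_self_eq_norm_sq_to_K, hT, hb, eig_norm, map_inv₀, Complex.conj_ofReal]
    simp only [Complex.coe_algebraMap]
    field_simp
  have e3 : ((∑ i : S, Real.sqrt (hA.eigenvalues i.1) : ℝ) : ℂ)
      = ∑ a, ∑ i : S, ⟪v a, b i.1⟫_ℂ * ⟪w i, u a⟫_ℂ := by
    push_cast
    rw [Finset.sum_comm]
    refine Finset.sum_congr rfl fun i _ => ?_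
    rw [e2, hTx, inner_sum]
    simp [inner_smul_right]
  have e4 : ∑ i : S, Real.sqrt (hA.eigenvalues i.1)
      = ‖∑ a, ∑ i : S, ⟪v a, b i.1⟫_ℂ * ⟪w i, u a⟫_ℂ‖ := by
    rw [← e3, Complex.norm_real, Real.norm_of_nonneg]
    exact Finset.sum_nonneg fun i _ => Real.sqrt_nonneg _
  rw [e1, e4]
  refine (norm_sum_le _ _).trans (Finset.sum_le_sum fun a _ => ?_)
  refine (norm_sum_le _ _).trans ?_
  simp only [norm_mul]
  refine (Real.sum_mul_le_sqrt_mul_sqrt _ _ _).trans ?_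
  rw [mul_comm]
  gcongr
  · refine Real.sqrt_le_iff.mpr ⟨norm_nonneg _, hw.sum_inner_products_le _⟩
  · refine Real.sqrt_le_iff.mpr ⟨norm_nonneg _, ?_⟩
    have := hbS.sum_inner_products_le (v a) (s := Finset.univ)
    simpa only [norm_inner_symm] using this

lemma schmidt_decomp {d r : ℕ} (M : Matrix (Fin d) (Fin d) ℂ) (hr : M.rank ≤ r)
    (hM : ∑ ij : Fin d × Fin d, Complex.normSq (M ij.1 ij.2) = 1) :
    ∃ u v : Fin d → EuclideanSpace ℂ (Fin d),
      (∀ a c, M a c = ∑ i, u i a * star (v i c)) ∧ (∀ i, ‖v i‖ = 1) ∧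
      (∑ i, ‖u i‖) ^ 2 ≤ (r : ℝ) := by
  classical
  have hp := Matrix.posSemidef_conjTranspose_mul_self M
  have hA : (Mᴴ * M).IsHermitian := hp.1
  refine ⟨fun i => Matrix.toEuclideanLin M (hA.eigenvectorBasis i), hA.eigenvectorBasis,
    ?_, fun i => hA.eigenvectorBasis.orthonormal.1 i, ?_⟩
  · intro a c
    have h := congrArg (fun x => (Matrix.toEuclideanLin M x) a)
      (hA.eigenvectorBasis.sum_repr' (EuclideanSpace.single c (1 : ℂ)))
    simp only [map_sum, map_smul, WithLp.ofLp_sum, Finset.sum_apply, WithLp.ofLp_smul,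
      Pi.smul_apply, smul_eq_mul, EuclideanSpace.inner_single_right] at h
    rw [show (Matrix.toEuclideanLin M (EuclideanSpace.single c (1 : ℂ))) a = M a c by
      simp [Matrix.ofLp_toLpLin]] at h
    rw [← h]
    refine Finset.sum_congr rfl fun i _ => ?_
    simp [mul_comm]
  · simp only [eig_norm]
    have htr : ∑ i, hA.eigenvalues i = 1 := by
      have h := hA.trace_eq_sum_eigenvalues
      have h' : (Mᴴ * M).trace = ((∑ ij : Fin d × Fin d, Complex.normSq (M ij.1 ij.2) : ℝ) : ℂ) := by
        rw [Fintype.sum_prod_type_right]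
        simp [Matrix.trace, Matrix.mul_apply, Complex.normSq_eq_conj_mul_self]
      rw [h', hM] at h
      exact Complex.ofReal_injective (by simpa using h.symm)
    have hc : (Finset.univ.filter fun i => Real.sqrt (hA.eigenvalues i) ≠ 0).card ≤ r := by
      refine le_trans (le_of_eq ?_) hr
      rw [← Matrix.rank_conjTranspose_mul_self M, hA.rank_eq_card_non_zero_eigs,
        Fintype.card_subtype]
      congr 1
      ext i
      simp [Real.sqrt_eq_zero (hp.eigenvalues_nonneg i)]
    rw [← Finset.sum_filter_ne_zero]
    refine sq_sum_le_card_mul_sum_sq.trans ?_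
    have h3 : ∑ i ∈ Finset.univ.filter (fun i => Real.sqrt (hA.eigenvalues i) ≠ 0),
        Real.sqrt (hA.eigenvalues i) ^ 2 ≤ 1 := by
      rw [← htr]
      refine (Finset.sum_le_sum_of_subset_of_nonneg (Finset.subset_univ _)
        fun i _ _ => sq_nonneg _).trans (le_of_eq ?_)
      exact Finset.sum_congr rfl fun i _ => Real.sq_sqrt (hp.eigenvalues_nonneg i)
    have h4 : ((Finset.univ.filter fun i => Real.sqrt (hA.eigenvalues i) ≠ 0).card : ℝ) ≤ r := by
      exact_mod_cast hc
    have h5 : (0 : ℝ) ≤ r := Nat.cast_nonneg r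
    calc _ ≤ (r : ℝ) * 1 := by gcongr
      _ = r := mul_one _

noncomputable def tens {d : ℕ} (x y : EuclideanSpace ℂ (Fin d)) :
    EuclideanSpace ℂ (Fin d × Fin d) :=
  WithLp.toLp 2 fun p => x p.1 * star (y p.2)

lemma norm_tens {d : ℕ} (x y : EuclideanSpace ℂ (Fin d)) : ‖tens x y‖ = ‖x‖ * ‖y‖ := by
  rw [EuclideanSpace.norm_eq, EuclideanSpace.norm_eq, EuclideanSpace.norm_eq,
    ← Real.sqrt_mul (by positivity), Fintype.sum_prod_type, Finset.sum_mul_sum]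
  simp [tens, mul_pow]

theorem stmt_15 (d r : ℕ) (hd : 1 ≤ d) (hr : 1 ≤ r)
    (ρ : Matrix (Fin d × Fin d) (Fin d × Fin d) ℂ)
    (hρ : IsDensityMatrix ρ) (hSN : SchmidtNumberLE d r ρ) :
    ∑ i, Real.sqrt
        ((Matrix.posSemidef_conjTranspose_mul_self (realign ρ)).1.eigenvalues i) ≤
      (r : ℝ) := by
  obtain ⟨K, p, ψ, hp0, hp1, hψ, hrk, hρe⟩ := hSN
  choose u v hM hv hu using fun k => schmidt_decomp (assocMatrix (ψ k)) (hrk k)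
    (by simpa [assocMatrix] using hψ k)
  refine (trace_norm_le (ι := Fin K × Fin d × Fin d) (realign ρ) _
    (fun a => (p a.1 : ℂ) • tens (u a.1 a.2.1) (u a.1 a.2.2))
    (fun a => tens (v a.1 a.2.1) (v a.1 a.2.2)) ?_).trans ?_
  · intro x y
    have hM' : ∀ k i j, ψ k (i, j) = ∑ l, u k l i * star (v k l j) := fun k i j => hM k i j
    simp only [realign, Matrix.of_apply, hρe, Matrix.sum_apply, Matrix.smul_apply,
      Matrix.vecMulVec_apply, Pi.star_apply, hM', smul_eq_mul, Fintype.sum_prod_type, tens,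
      WithLp.ofLp_smul, Pi.smul_apply, star_sum]
    refine Finset.sum_congr rfl fun k _ => ?_
    rw [Finset.sum_mul_sum]
    simp only [Finset.mul_sum]
    refine Finset.sum_congr rfl fun i _ =>
      Finset.sum_congr rfl fun j _ => ?_
    simp only [star_mul', star_star]
    ring
  · simp only [norm_smul, norm_tens, hv, mul_one, Complex.norm_real, Fintype.sum_prod_type]
    calc _ = ∑ k, p k * (∑ i, ‖u k i‖) ^ 2 := by
          refine Finset.sum_congr rfl fun k _ => ?_
          rw [sq, Finset.sum_mul_sum, Finset.mul_sum]
          simp only [Finset.mul_sum, Real.norm_of_nonneg (hp0 k)]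
      _ ≤ ∑ k, p k * (r : ℝ) :=
          Finset.sum_le_sum fun k _ => mul_le_mul_of_nonneg_left (hu k) (hp0 k)
      _ = r := by rw [← Finset.sum_mul, hp1, one_mul]
end
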